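/- Let ρ = e^{−V} be a probability density on ℝⁿ with V : ℝⁿ → ℝ convex, and for δ > 0 let m_δ be the unique point satisfying ∫ x e^{−δ|x−m_δ|²/2} ρ(x) dx = m_δ ∫ e^{−δ|x−m_δ|²/2} ρ(x) dx. Then for every δ > 0, |m_δ| ≤ exp( (δ/2)·∫_{ℝⁿ} |x|² ρ(x) dx ) · ∫_{ℝⁿ} |x| ρ(x) dx. -/

import Mathlib

open MeasureTheory

section

open Set
open scoped ENNReal

theorem volume_add_le_of_forall_isCompact {A : Set ℝ} (hA : MeasurableSet A) (hne : A.Nonempty)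
    {c d : ℝ≥0∞} (h : ∀ K ⊆ A, IsCompact K → K.Nonempty → volume K + c ≤ d) :
    volume A + c ≤ d := by
  obtain ⟨a, ha⟩ := hne
  have hcd : c ≤ d := by
    simpa using h {a} (singleton_subset_iff.2 ha) isCompact_singleton (singleton_nonempty a)
  rcases eq_or_ne c ⊤ with rfl | hc
  · simpa using hcd
  suffices volume A ≤ d - c from (add_le_add_left this c).trans_eq (tsub_add_cancel_of_le hcd)
  refine le_of_forall_lt fun r hr => ?_
  obtain ⟨K, hKA, hK, hrK⟩ := hA.exists_lt_isCompact hr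
  have hKne : K.Nonempty := by
    rw [nonempty_iff_ne_empty]
    rintro rfl
    simp at hrK
  exact hrK.trans_le (ENNReal.le_sub_of_add_le_right hc (h K hKA hK hKne))

/-- The one-dimensional Brunn–Minkowski inequality for midpoints. -/
theorem volume_add_volume_le_two_mul_of_midpoint_mem {A B C : Set ℝ} (hA : MeasurableSet A)
    (hB : MeasurableSet B) (hAne : A.Nonempty) (hBne : B.Nonempty)
    (h : ∀ a ∈ A, ∀ b ∈ B, (a + b) / 2 ∈ C) :
    volume A + volume B ≤ 2 * volume C := by
  have hC : volume ((fun z => 2⁻¹ * z) ⁻¹' C) = 2 * volume C := by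
    rw [Real.volume_preimage_mul_left (by norm_num)]
    norm_num
  rw [← hC]
  refine volume_add_le_of_forall_isCompact hA hAne fun K hKA hK hKne => ?_
  rw [add_comm]
  refine volume_add_le_of_forall_isCompact hB hBne fun L hLB hL hLne => ?_
  obtain ⟨k, hk⟩ := hK.exists_isGreatest hKne
  obtain ⟨l, hl⟩ := hL.exists_isLeast hLne
  have hdisj : AEDisjoint volume ((fun y => -k + y) ⁻¹' L) ((fun x => -l + x) ⁻¹' K) := by
    refine measure_mono_null (t := {k + l}) ?_ (by simp)
    rintro z ⟨hzL, hzK⟩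
    have h1 := hl.2 hzL
    have h2 := hk.2 hzK
    simp only [mem_singleton_iff]
    linarith
  have hmL : MeasurableSet ((fun y => -k + y) ⁻¹' L) :=
    hL.measurableSet.preimage (measurable_const_add _)
  have hmK : MeasurableSet ((fun x => -l + x) ⁻¹' K) :=
    hK.measurableSet.preimage (measurable_const_add _)
  calc volume L + volume K
      = volume ((fun y => -k + y) ⁻¹' L) + volume ((fun x => -l + x) ⁻¹' K) := by
        rw [measure_preimage_add, measure_preimage_add]
    _ = volume ((fun y => -k + y) ⁻¹' L ∪ (fun x => -l + x) ⁻¹' K) :=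
        (measure_union₀ hmK.nullMeasurableSet hdisj).symm
    _ ≤ _ := by
        refine measure_mono (union_subset (fun z hz => ?_) fun z hz => ?_)
        · have := h k (hKA hk.1) _ (hLB hz)
          simp only [mem_preimage]
          convert this using 1
          ring
        · have := h _ (hKA hz) l (hLB hl.1)
          simp only [mem_preimage]
          convert this using 1
          ring

theorem lintegral_eq_setLIntegral_meas_lt_of_le_one {f : ℝ → ℝ≥0∞} (hf : Measurable f)
    (h1 : ∀ x, f x ≤ 1) :
    ∫⁻ x, f x = ∫⁻ t in Ioo (0 : ℝ) 1, volume {x | ENNReal.ofReal t < f x} := by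
  have hfin : ∀ x, f x ≠ ⊤ := fun x => ne_top_of_le_ne_top ENNReal.one_ne_top (h1 x)
  have hlt : ∀ t ∈ Ioi (0 : ℝ), {x | t < (f x).toReal} = {x | ENNReal.ofReal t < f x} := by
    intro t ht
    ext x
    exact (ENNReal.ofReal_lt_iff_lt_toReal (le_of_lt ht) (hfin x)).symm
  calc ∫⁻ x, f x = ∫⁻ x, ENNReal.ofReal (f x).toReal := by
        simp_rw [ENNReal.ofReal_toReal (hfin _)]
    _ = ∫⁻ t in Ioi (0 : ℝ), volume {x | t < (f x).toReal} :=
        lintegral_eq_lintegral_meas_lt _ (ae_of_all _ fun x => ENNReal.toReal_nonneg)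
          hf.ennreal_toReal.aemeasurable
    _ = ∫⁻ t in Ioi (0 : ℝ), volume {x | ENNReal.ofReal t < f x} :=
        setLIntegral_congr_fun measurableSet_Ioi fun t ht => by simp only [hlt t ht]
    _ = _ := by
        rw [← Ioo_union_Ici_eq_Ioi (zero_lt_one' ℝ), lintegral_union measurableSet_Ici
          (by rw [Set.disjoint_left]; intro x hx hx'; exact absurd hx.2 (not_lt.2 hx'))]
        have : ∫⁻ t in Ici (1 : ℝ), volume {x | ENNReal.ofReal t < f x} = 0 := by
          rw [setLIntegral_congr_fun (g := fun _ => 0) measurableSet_Ici, lintegral_zero]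
          intro t ht
          have : {x | ENNReal.ofReal t < f x} = ∅ := by
            ext x
            simpa using (h1 x).trans (ENNReal.one_le_ofReal.2 ht)
          simp [this]
        rw [this, add_zero]

theorem ENNReal.mul_le_sq_of_add_le_two_mul {a b c : ℝ≥0∞} (h : a + b ≤ 2 * c) :
    a * b ≤ c ^ 2 := by
  rcases eq_or_ne c ⊤ with rfl | hc
  · simp
  have hab : a + b ≠ ⊤ := ne_top_of_le_ne_top (by finiteness) h
  lift a to NNReal using (fun h => hab (by simp [h]))
  lift b to NNReal using (fun h => hab (by simp [h]))
  lift c to NNReal using hc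
  norm_cast at *
  have h' : (a : ℝ) + b ≤ 2 * c := by exact_mod_cast h
  have : (a : ℝ) * b ≤ c ^ 2 := by
    nlinarith [sq_nonneg ((a : ℝ) - b), a.2, b.2, c.2, sq_nonneg ((a : ℝ) + b)]
  exact_mod_cast this

/-- The one-dimensional Prékopa–Leindler inequality for functions with supremum one. -/
theorem lintegral_add_lintegral_le_of_iSup_eq_one {f g h : ℝ → ℝ≥0∞} (hf : Measurable f)
    (hg : Measurable g) (hh : Measurable h) (hf1 : ⨆ x, f x = 1) (hg1 : ⨆ x, g x = 1)
    (H : ∀ x y, f x * g y ≤ h ((x + y) / 2) ^ 2) :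
    (∫⁻ x, f x) + ∫⁻ x, g x ≤ 2 * ∫⁻ x, h x := by
  have hf1' : ∀ x, f x ≤ 1 := fun x => hf1 ▸ le_iSup f x
  have hg1' : ∀ x, g x ≤ 1 := fun x => hg1 ▸ le_iSup g x
  have hmin : ∫⁻ x, min (h x) 1 ≤ ∫⁻ x, h x := lintegral_mono fun x => min_le_left _ _
  refine le_trans ?_ (mul_le_mul_right hmin 2)
  rw [lintegral_eq_setLIntegral_meas_lt_of_le_one hf hf1',
    lintegral_eq_setLIntegral_meas_lt_of_le_one hg hg1',
    lintegral_eq_setLIntegral_meas_lt_of_le_one (hh.min measurable_const)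
      fun x => min_le_right _ _, ← lintegral_const_mul' _ _ (by simp)]
  refine (le_lintegral_add _ _).trans (setLIntegral_mono' measurableSet_Ioo fun t ht => ?_)
  have ht1 : ENNReal.ofReal t < 1 := by simpa using ht.2
  refine volume_add_volume_le_two_mul_of_midpoint_mem (measurableSet_lt measurable_const hf)
    (measurableSet_lt measurable_const hg) (lt_iSup_iff.1 (ht1.trans_eq hf1.symm))
    (lt_iSup_iff.1 (ht1.trans_eq hg1.symm)) fun x hx y hy => ?_
  refine lt_min ?_ ht1
  by_contra hle
  have h1 : h ((x + y) / 2) ^ 2 ≤ ENNReal.ofReal t ^ 2 := by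
    gcongr
    exact not_lt.1 hle
  have h2 : ENNReal.ofReal t ^ 2 < f x * g y := by
    rw [sq]
    exact ENNReal.mul_lt_mul hx hy
  exact absurd ((H x y).trans h1) (not_le.2 h2)

theorem lintegral_mul_lintegral_le_of_iSup_ne_top {f g h : ℝ → ℝ≥0∞} (hf : Measurable f)
    (hg : Measurable g) (hh : Measurable h) (hfT : ⨆ x, f x ≠ ⊤) (hgT : ⨆ x, g x ≠ ⊤)
    (H : ∀ x y, f x * g y ≤ h ((x + y) / 2) ^ 2) :
    (∫⁻ x, f x) * ∫⁻ x, g x ≤ (∫⁻ x, h x) ^ 2 := by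
  set a := ⨆ x, f x with ha
  set b := ⨆ x, g x with hb
  rcases eq_or_ne a 0 with ha0 | ha0
  · have : ∀ x, f x = 0 := fun x => le_zero_iff.1 (ha0 ▸ le_iSup f x)
    simp [this]
  rcases eq_or_ne b 0 with hb0 | hb0
  · have : ∀ x, g x = 0 := fun x => le_zero_iff.1 (hb0 ▸ le_iSup g x)
    simp [this]
  set c := (a * b) ^ (1 / 2 : ℝ) with hc
  have hab0 : a * b ≠ 0 := mul_ne_zero ha0 hb0
  have habT : a * b ≠ ⊤ := ENNReal.mul_ne_top hfT hgT
  have hc2 : c ^ 2 = a * b := by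
    rw [hc, ← ENNReal.rpow_natCast, ← ENNReal.rpow_mul]
    norm_num
  have hc0 : c ≠ 0 := fun h0 => hab0 (by rw [← hc2, h0]; simp)
  have hcT : c ≠ ⊤ := fun h0 => habT (by rw [← hc2, h0]; simp)
  have key := lintegral_add_lintegral_le_of_iSup_eq_one (hf.const_mul a⁻¹) (hg.const_mul b⁻¹)
    (hh.const_mul c⁻¹) (by rw [← ENNReal.mul_iSup, ← ha, ENNReal.inv_mul_cancel ha0 hfT])
    (by rw [← ENNReal.mul_iSup, ← hb, ENNReal.inv_mul_cancel hb0 hgT]) (fun x y => by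
      have : a⁻¹ * f x * (b⁻¹ * g y) = (a * b)⁻¹ * (f x * g y) := by
        rw [ENNReal.mul_inv (Or.inl ha0) (Or.inl hfT)]
        ring
      rw [this, mul_pow, ← ENNReal.inv_pow, hc2]
      gcongr
      exact H x y)
  have := ENNReal.mul_le_sq_of_add_le_two_mul key
  rw [lintegral_const_mul _ hf, lintegral_const_mul _ hg, lintegral_const_mul _ hh, mul_pow,
    ← ENNReal.inv_pow, hc2] at this
  have h3 : a⁻¹ * (∫⁻ x, f x) * (b⁻¹ * ∫⁻ x, g x)
      = (a * b)⁻¹ * ((∫⁻ x, f x) * ∫⁻ x, g x) := by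
    rw [ENNReal.mul_inv (Or.inl ha0) (Or.inl hfT)]
    ring
  rw [h3] at this
  exact (ENNReal.mul_le_mul_iff_right (ENNReal.inv_ne_zero.2 habT) (ENNReal.inv_ne_top.2 hab0)).1
    this

theorem ENNReal.iSup_min_natCast (a : ℝ≥0∞) : ⨆ n : ℕ, min a n = a := by
  have : (⨆ n : ℕ, a ⊓ (n : ℝ≥0∞)) = a ⊓ ⨆ n : ℕ, (n : ℝ≥0∞) := (inf_iSup_eq _ _).symm
  rw [ENNReal.iSup_natCast, inf_top_eq] at this
  exact this

theorem lintegral_eq_iSup_lintegral_min_natCast {f : ℝ → ℝ≥0∞} (hf : Measurable f) :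
    ∫⁻ x, f x = ⨆ n : ℕ, ∫⁻ x, min (f x) n := by
  rw [← lintegral_iSup (fun n => hf.min measurable_const)
    fun m n hmn x => min_le_min le_rfl (by exact_mod_cast hmn)]
  simp_rw [ENNReal.iSup_min_natCast]

/-- The one-dimensional **Prékopa–Leindler inequality** for midpoints. -/
theorem lintegral_mul_lintegral_le_sq_real {f g h : ℝ → ℝ≥0∞} (hf : Measurable f)
    (hg : Measurable g) (hh : Measurable h)
    (H : ∀ x y, f x * g y ≤ h ((x + y) / 2) ^ 2) :
    (∫⁻ x, f x) * ∫⁻ x, g x ≤ (∫⁻ x, h x) ^ 2 := by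
  have key : ∀ m : ℕ, (∫⁻ x, min (f x) m) * ∫⁻ x, min (g x) m ≤ (∫⁻ x, h x) ^ 2 := by
    intro m
    have hT : ∀ u : ℝ → ℝ≥0∞, ⨆ x, min (u x) m ≠ ⊤ := fun u =>
      ne_top_of_le_ne_top (ENNReal.natCast_ne_top m) (iSup_le fun x => min_le_right _ _)
    exact lintegral_mul_lintegral_le_of_iSup_ne_top (hf.min measurable_const)
      (hg.min measurable_const) hh (hT f) (hT g)
      fun x y => (mul_le_mul' (min_le_left _ _) (min_le_left _ _)).trans (H x y)
  have hmono : ∀ u : ℝ → ℝ≥0∞, Monotone fun m : ℕ => ∫⁻ x, min (u x) m :=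
    fun u m n hmn => lintegral_mono fun x => min_le_min le_rfl (by exact_mod_cast hmn)
  rw [lintegral_eq_iSup_lintegral_min_natCast hf, lintegral_eq_iSup_lintegral_min_natCast hg]
  simp_rw [ENNReal.iSup_mul, ENNReal.mul_iSup]
  exact iSup_le fun i => iSup_le fun j => (mul_le_mul' (hmono f (le_max_left i j))
    (hmono g (le_max_right i j))).trans (key (max i j))

/-- The **Prékopa–Leindler inequality** for midpoints, for marginals of functions on `ι → ℝ`. -/
theorem lmarginal_mul_lmarginal_le_sq {ι : Type*} [DecidableEq ι] {f g h : (ι → ℝ) → ℝ≥0∞}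
    (hf : Measurable f) (hg : Measurable g) (hh : Measurable h)
    (H : ∀ x y, f x * g y ≤ h ((2⁻¹ : ℝ) • (x + y)) ^ 2) (s : Finset ι) (x y : ι → ℝ) :
    lmarginal (fun _ => volume) s f x * lmarginal (fun _ => volume) s g y ≤
      lmarginal (fun _ => volume) s h ((2⁻¹ : ℝ) • (x + y)) ^ 2 := by
  induction s using Finset.induction_on generalizing x y with
  | empty => simpa using H x y
  | insert i s hi ih =>
    rw [lmarginal_insert _ hf hi, lmarginal_insert _ hg hi, lmarginal_insert _ hh hi]
    have hm : ∀ (u : (ι → ℝ) → ℝ≥0∞) (z : ι → ℝ), Measurable u →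
        Measurable fun t => lmarginal (fun _ => volume) s u (Function.update z i t) :=
      fun u z hu => (hu.lmarginal _).comp (measurable_update z)
    refine lintegral_mul_lintegral_le_sq_real (hm f x hf) (hm g y hg) (hm h _ hh) fun t u => ?_
    have : Function.update ((2⁻¹ : ℝ) • (x + y)) i ((t + u) / 2) =
        (2⁻¹ : ℝ) • (Function.update x i t + Function.update y i u) := by
      ext j
      rcases eq_or_ne j i with rfl | hj
      · simp
        ring
      · simp [hj, mul_add]
    rw [this]
    exact ih _ _

/-- The **Prékopa–Leindler inequality** for midpoints. -/
theorem lintegral_mul_lintegral_le_sq {ι : Type*} [Fintype ι]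
    {f g h : EuclideanSpace ℝ ι → ℝ≥0∞}
    (hf : Measurable f) (hg : Measurable g) (hh : Measurable h)
    (H : ∀ x y, f x * g y ≤ h ((2⁻¹ : ℝ) • (x + y)) ^ 2) :
    (∫⁻ x, f x) * ∫⁻ x, g x ≤ (∫⁻ x, h x) ^ 2 := by
  classical
  have hT := PiLp.volume_preserving_toLp ι
  have := lmarginal_mul_lmarginal_le_sq (hf.comp hT.measurable) (hg.comp hT.measurable)
    (hh.comp hT.measurable) (fun x y => by simpa using H (WithLp.toLp 2 x) (WithLp.toLp 2 y))
    Finset.univ 0 0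
  simp only [lmarginal_univ, ← volume_pi, Function.comp_apply] at this
  rwa [hT.lintegral_comp hf, hT.lintegral_comp hg, hT.lintegral_comp hh] at this

section Moments

variable {E : Type*} [NormedAddCommGroup E] [NormedSpace ℝ E] [FiniteDimensional ℝ E]

theorem ConvexOn.continuous_of_univ {V : E → ℝ} (hV : ConvexOn ℝ univ V) : Continuous V :=
  continuousOn_univ.1 (hV.continuousOn isOpen_univ)

variable [MeasurableSpace E] [BorelSpace E] {μ : Measure E} [μ.IsAddHaarMeasure]

theorem ConvexOn.exists_forall_norm_le_of_integrable_exp_neg {V : E → ℝ}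
    (hV : ConvexOn ℝ univ V) (hint : Integrable (fun x => Real.exp (-V x)) μ) :
    ∃ R > 0, ∀ x, V x ≤ V 0 + 1 → ‖x‖ ≤ R := by
  have hcont := hV.continuous_of_univ
  obtain ⟨r, hr, hball⟩ := Metric.eventually_nhds_iff_ball.1
    (hcont.continuousAt.eventually_lt_const (show V 0 < V 0 + 1 by linarith))
  set ν := μ.withDensity fun x => ENNReal.ofReal (Real.exp (-V x)) with hν
  have : IsFiniteMeasure ν := isFiniteMeasure_withDensity_ofReal hint.2
  set m := ENNReal.ofReal (Real.exp (-(V 0 + 1))) * μ (Metric.ball 0 (r / 2)) with hm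
  have hm0 : m ≠ 0 := mul_ne_zero (by simp [Real.exp_pos])
    (Metric.measure_ball_pos μ 0 (half_pos hr)).ne'
  have hmT : m ≠ ⊤ := ENNReal.mul_ne_top ENNReal.ofReal_ne_top measure_ball_lt_top.ne
  obtain ⟨K, hK, hKle⟩ := isTightMeasureSet_iff_exists_isCompact_measure_compl_le.1
    (isTightMeasureSet_singleton (μ := ν)) (m / 2) (ENNReal.half_pos hm0)
  obtain ⟨R, hR0, hR⟩ := hK.isBounded.exists_pos_norm_le
  refine ⟨2 * (R + r), by positivity, fun x hx => ?_⟩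
  by_contra! hlt
  have hsub : Metric.ball ((2⁻¹ : ℝ) • x) (r / 2) ⊆ Kᶜ := fun y hy hyK => by
    have h1 := hR y hyK
    rw [mem_ball_iff_norm'] at hy
    have h2 : ‖(2⁻¹ : ℝ) • x‖ = 2⁻¹ * ‖x‖ := by rw [norm_smul]; norm_num
    have h3 := norm_sub_norm_le ((2⁻¹ : ℝ) • x) y
    linarith
  have hVle : ∀ y ∈ Metric.ball ((2⁻¹ : ℝ) • x) (r / 2), V y ≤ V 0 + 1 := fun y hy => by
    rw [mem_ball_iff_norm] at hy
    have h1 : V ((2 : ℝ) • (y - (2⁻¹ : ℝ) • x)) < V 0 + 1 := hball _ (by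
      rw [mem_ball_zero_iff, norm_smul]
      norm_num
      norm_num at hy
      linarith)
    have h2 := hV.2 (mem_univ x) (mem_univ ((2 : ℝ) • (y - (2⁻¹ : ℝ) • x)))
      (show (0 : ℝ) ≤ 2⁻¹ by norm_num) (show (0 : ℝ) ≤ 2⁻¹ by norm_num) (by norm_num)
    have h3 : (2⁻¹ : ℝ) • x + (2⁻¹ : ℝ) • (2 : ℝ) • (y - (2⁻¹ : ℝ) • x) = y := by
      module
    rw [h3] at h2
    simp only [smul_eq_mul] at h2
    linarith
  have hge : m ≤ ν (Metric.ball ((2⁻¹ : ℝ) • x) (r / 2)) := by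
    rw [hν, withDensity_apply _ measurableSet_ball, hm,
      ← Measure.addHaar_ball_center μ ((2⁻¹ : ℝ) • x), ← setLIntegral_const]
    refine setLIntegral_mono' measurableSet_ball fun y hy => ?_
    gcongr
    exact hVle y hy
  have := (hge.trans (measure_mono hsub)).trans (hKle ν rfl)
  exact absurd this (not_le.2 (ENNReal.half_lt_self hm0 hmT))

theorem ConvexOn.exists_forall_mul_norm_sub_le_of_integrable_exp_neg {V : E → ℝ}
    (hV : ConvexOn ℝ univ V) (hint : Integrable (fun x => Real.exp (-V x)) μ) :
    ∃ a > 0, ∃ b, ∀ x, a * ‖x‖ - b ≤ V x := by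
  obtain ⟨R, hR, hle⟩ := hV.exists_forall_norm_le_of_integrable_exp_neg hint
  obtain ⟨c, hc⟩ := ((isCompact_closedBall (0 : E) (R + 1)).image
    hV.continuous_of_univ).bddBelow
  refine ⟨(R + 1)⁻¹, by positivity, max (-V 0) (1 - c), fun x => ?_⟩
  rcases le_or_gt ‖x‖ (R + 1) with hx | hx
  · have h1 : c ≤ V x := hc (mem_image_of_mem _ (by simpa using hx))
    have h2 : (R + 1)⁻¹ * ‖x‖ ≤ 1 := (inv_mul_le_iff₀ (by positivity)).2 (by linarith)
    have h3 := le_max_right (-V 0) (1 - c)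
    linarith
  · have hx0 : 0 < ‖x‖ := by linarith
    set t := (R + 1) / ‖x‖ with ht
    have ht0 : 0 < t := by positivity
    have ht1 : t ≤ 1 := (div_le_one hx0).2 hx.le
    have hnorm : ‖t • x‖ = R + 1 := by
      rw [norm_smul, Real.norm_of_nonneg ht0.le, ht, div_mul_cancel₀ _ hx0.ne']
    have h1 : V 0 + 1 < V (t • x) := by
      by_contra! h
      linarith [hle _ h]
    have h2 := hV.2 (mem_univ (0 : E)) (mem_univ x) (sub_nonneg.2 ht1) ht0.le (by ring)
    simp only [smul_zero, zero_add, smul_eq_mul] at h2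
    have h3 : 1 < t * (V x - V 0) := by linarith
    have h4 : (R + 1)⁻¹ * ‖x‖ ≤ V x - V 0 := by
      have : (R + 1)⁻¹ * ‖x‖ = 1 / t := by rw [ht]; field_simp
      rw [this, div_le_iff₀ ht0]
      linarith
    have h5 := le_max_left (-V 0) (1 - c)
    linarith

theorem Real.exp_neg_mul_mul_one_add_pow_le {a t : ℝ} (ha : 0 < a) (ht : 0 ≤ t) (N : ℕ) :
    Real.exp (-(a * t)) * (1 + t) ^ N ≤ Real.exp a * N.factorial / a ^ N := by
  have h := Real.pow_div_factorial_le_exp (a * (1 + t)) (by positivity) N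
  rw [div_le_iff₀ (by positivity), mul_pow, mul_add, Real.exp_add, mul_one] at h
  rw [le_div_iff₀ (by positivity), Real.exp_neg, mul_assoc, inv_mul_le_iff₀ (Real.exp_pos _)]
  linarith

/-- Log-concave densities have moments of all orders. -/
theorem ConvexOn.integrable_norm_pow_mul_exp_neg {V : E → ℝ}
    (hV : ConvexOn ℝ univ V) (hint : Integrable (fun x => Real.exp (-V x)) μ) (k : ℕ) :
    Integrable (fun x => ‖x‖ ^ k * Real.exp (-V x)) μ := by
  obtain ⟨a, ha, b, hab⟩ := hV.exists_forall_mul_norm_sub_le_of_integrable_exp_neg hint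
  set d := Module.finrank ℝ E
  set C := Real.exp a * (k + (d + 1)).factorial / a ^ (k + (d + 1))
  have hdom : Integrable (fun x : E => Real.exp b * C * (1 + ‖x‖) ^ (-((d + 1 : ℕ) : ℝ))) μ :=
    (integrable_one_add_norm (by simp [d])).const_mul _
  have hcont : Continuous fun x => ‖x‖ ^ k * Real.exp (-V x) := by
    have := hV.continuous_of_univ
    fun_prop
  refine hdom.mono' hcont.aestronglyMeasurable (ae_of_all _ fun x => ?_)
  have hpos : 0 < 1 + ‖x‖ := by positivity
  rw [Real.norm_of_nonneg (by positivity), Real.rpow_neg hpos.le, Real.rpow_natCast,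
    ← div_eq_mul_inv, le_div_iff₀ (by positivity)]
  calc ‖x‖ ^ k * Real.exp (-V x) * (1 + ‖x‖) ^ (d + 1)
      ≤ (1 + ‖x‖) ^ k * Real.exp (b + -(a * ‖x‖)) * (1 + ‖x‖) ^ (d + 1) := by
        gcongr
        · linarith
        · linarith [hab x]
    _ = Real.exp b * (Real.exp (-(a * ‖x‖)) * (1 + ‖x‖) ^ (k + (d + 1))) := by
        rw [Real.exp_add, pow_add]
        ring
    _ ≤ Real.exp b * C := by
        gcongr
        exact Real.exp_neg_mul_mul_one_add_pow_le ha (norm_nonneg x) _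

end Moments

section Barycenter

open Filter Topology
open scoped RealInnerProductSpace

theorem apply_le_of_hasDerivAt_zero_of_midpoint_concave {L : ℝ → ℝ} {p q : ℝ}
    (hderiv : HasDerivAt L 0 p) (hL : ∀ s, (L s + L p) / 2 ≤ L ((s + p) / 2)) : L q ≤ L p := by
  by_contra! hlt
  have hseq : ∀ k : ℕ, (2⁻¹ : ℝ) ^ k * (L q - L p) ≤ L (p + (2⁻¹ : ℝ) ^ k * (q - p)) - L p := by
    intro k
    induction k with
    | zero => simp
    | succ k ih =>
      have h := hL (p + (2⁻¹ : ℝ) ^ k * (q - p))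
      rw [show (p + (2⁻¹ : ℝ) ^ k * (q - p) + p) / 2 = p + (2⁻¹ : ℝ) ^ (k + 1) * (q - p) by ring]
        at h
      rw [pow_succ]
      rw [pow_succ] at h
      linarith
  have hqp : 0 < |q - p| := abs_pos.2 (sub_ne_zero.2 fun h => by simp [h] at hlt)
  have hc : 0 < (L q - L p) / (2 * |q - p|) := div_pos (sub_pos.2 hlt) (by positivity)
  have hev := (hasDerivAt_iff_isLittleO.1 hderiv).bound hc
  have htend : Tendsto (fun k : ℕ => p + (2⁻¹ : ℝ) ^ k * (q - p)) atTop (𝓝 p) := by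
    have := (tendsto_pow_atTop_nhds_zero_of_lt_one (show (0 : ℝ) ≤ 2⁻¹ by norm_num)
      (by norm_num)).mul_const (q - p) |>.const_add p
    simpa using this
  obtain ⟨k, hk⟩ := (htend.eventually hev).exists
  have h1 := (hseq k).trans (le_abs_self _)
  have hpk : (0 : ℝ) < 2⁻¹ ^ k := by positivity
  simp only [smul_zero, sub_zero, add_sub_cancel_left, Real.norm_eq_abs, abs_mul,
    abs_of_pos hpk] at hk
  have h2 : (L q - L p) / (2 * |q - p|) * (2⁻¹ ^ k * |q - p|) = 2⁻¹ ^ k * (L q - L p) / 2 := by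
    field_simp
  rw [h2] at hk
  have := mul_pos hpk (sub_pos.2 hlt)
  linarith

variable {ι : Type*} [Fintype ι] {V : EuclideanSpace ℝ ι → ℝ} {δ : ℝ}

/-- The unnormalized density `ρ = e^{-V}` reweighted by a Gaussian factor centered at `c`. -/
noncomputable def gaussianReweight (V : EuclideanSpace ℝ ι → ℝ) (δ : ℝ)
    (c x : EuclideanSpace ℝ ι) : ℝ :=
  Real.exp (-(δ * ‖x - c‖ ^ 2 / 2)) * Real.exp (-V x)

theorem gaussianReweight_pos (c x : EuclideanSpace ℝ ι) : 0 < gaussianReweight V δ c x :=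
  mul_pos (Real.exp_pos _) (Real.exp_pos _)

theorem gaussianReweight_le (hδ : 0 ≤ δ) (c x : EuclideanSpace ℝ ι) :
    gaussianReweight V δ c x ≤ Real.exp (-V x) :=
  mul_le_of_le_one_left (Real.exp_pos _).le
    (Real.exp_le_one_iff.2 (neg_nonpos.2 (by positivity)))

theorem continuous_gaussianReweight (hV : ConvexOn ℝ univ V) (c : EuclideanSpace ℝ ι) :
    Continuous (gaussianReweight V δ c) := by
  have := hV.continuous_of_univ
  unfold gaussianReweight
  fun_prop

theorem integrable_gaussianReweight (hV : ConvexOn ℝ univ V)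
    (hint : Integrable fun x => Real.exp (-V x)) (hδ : 0 ≤ δ) (c : EuclideanSpace ℝ ι) :
    Integrable (gaussianReweight V δ c) :=
  hint.mono' (continuous_gaussianReweight hV c).aestronglyMeasurable <| ae_of_all _ fun x => by
    rw [Real.norm_of_nonneg (gaussianReweight_pos c x).le]
    exact gaussianReweight_le hδ c x

theorem integral_gaussianReweight_pos (hV : ConvexOn ℝ univ V)
    (hint : Integrable fun x => Real.exp (-V x)) (hδ : 0 ≤ δ) (c : EuclideanSpace ℝ ι) :
    0 < ∫ x, gaussianReweight V δ c x := by
  rw [integral_pos_iff_support_of_nonneg (fun x => (gaussianReweight_pos c x).le)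
    (integrable_gaussianReweight hV hint hδ c)]
  have : Function.support (gaussianReweight V δ c) = univ :=
    Function.support_eq_univ fun x => (gaussianReweight_pos c x).ne'
  rw [this]
  exact isOpen_univ.measure_pos _ univ_nonempty

theorem gaussianReweight_mul_le_sq (hV : ConvexOn ℝ univ V) (hδ : 0 ≤ δ)
    (c d x y : EuclideanSpace ℝ ι) :
    gaussianReweight V δ c x * gaussianReweight V δ d y ≤
      gaussianReweight V δ ((2⁻¹ : ℝ) • (c + d)) ((2⁻¹ : ℝ) • (x + y)) ^ 2 := by
  have hVm := hV.2 (mem_univ x) (mem_univ y) (show (0 : ℝ) ≤ 2⁻¹ by norm_num)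
    (show (0 : ℝ) ≤ 2⁻¹ by norm_num) (by norm_num)
  rw [← smul_add] at hVm
  simp only [smul_eq_mul] at hVm
  have hn : ‖(2⁻¹ : ℝ) • (x + y) - (2⁻¹ : ℝ) • (c + d)‖ ^ 2 ≤
      (‖x - c‖ ^ 2 + ‖y - d‖ ^ 2) / 2 := by
    have hp := parallelogram_law_with_norm ℝ (x - c) (y - d)
    rw [← smul_sub, norm_smul, show x + y - (c + d) = x - c + (y - d) by abel, mul_pow]
    norm_num
    nlinarith [mul_self_nonneg ‖x - c - (y - d)‖]
  have hδn := mul_le_mul_of_nonneg_left hn hδ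
  unfold gaussianReweight
  simp only [← Real.exp_add, ← Real.exp_nat_mul]
  rw [Real.exp_le_exp]
  push_cast
  linarith

theorem integral_gaussianReweight_mul_le_sq (hV : ConvexOn ℝ univ V)
    (hint : Integrable fun x => Real.exp (-V x)) (hδ : 0 ≤ δ) (c d : EuclideanSpace ℝ ι) :
    (∫ x, gaussianReweight V δ c x) * ∫ x, gaussianReweight V δ d x ≤
      (∫ x, gaussianReweight V δ ((2⁻¹ : ℝ) • (c + d)) x) ^ 2 := by
  have hnn : ∀ c x, 0 ≤ gaussianReweight V δ c x := fun c x => (gaussianReweight_pos c x).le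
  have hI : ∀ c, ENNReal.ofReal (∫ x, gaussianReweight V δ c x) =
      ∫⁻ x, ENNReal.ofReal (gaussianReweight V δ c x) := fun c =>
    ofReal_integral_eq_lintegral_ofReal (integrable_gaussianReweight hV hint hδ c)
      (ae_of_all _ (hnn c))
  have hm : ∀ c, Measurable fun x => ENNReal.ofReal (gaussianReweight V δ c x) := fun c =>
    (continuous_gaussianReweight hV c).measurable.ennreal_ofReal
  have key := lintegral_mul_lintegral_le_sq (hm c) (hm d) (hm ((2⁻¹ : ℝ) • (c + d)))
    fun x y => by
      rw [← ENNReal.ofReal_mul (hnn _ _), ← ENNReal.ofReal_pow (hnn _ _)]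
      exact ENNReal.ofReal_le_ofReal (gaussianReweight_mul_le_sq hV hδ c d x y)
  rw [← hI, ← hI, ← hI, ← ENNReal.ofReal_mul (integral_nonneg (hnn _)),
    ← ENNReal.ofReal_pow (integral_nonneg (hnn _))] at key
  exact (ENNReal.ofReal_le_ofReal_iff (by positivity)).1 key

theorem integrable_gaussianReweight_smul (hV : ConvexOn ℝ univ V)
    (hint : Integrable fun x => Real.exp (-V x)) (hδ : 0 ≤ δ) (c : EuclideanSpace ℝ ι) :
    Integrable fun x => gaussianReweight V δ c x • x := by
  have hmom : Integrable fun x => ‖x‖ * Real.exp (-V x) := by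
    simpa using hV.integrable_norm_pow_mul_exp_neg hint 1
  refine hmom.mono'
    ((continuous_gaussianReweight hV c).smul continuous_id).aestronglyMeasurable
    (ae_of_all _ fun x => ?_)
  rw [norm_smul, Real.norm_of_nonneg (gaussianReweight_pos c x).le, mul_comm]
  gcongr
  exact gaussianReweight_le hδ c x

theorem hasDerivAt_gaussianReweight_smul (m x : EuclideanSpace ℝ ι) (s : ℝ) :
    HasDerivAt (fun s : ℝ => gaussianReweight V δ (s • m) x)
      (δ * ⟪x - s • m, m⟫ * gaussianReweight V δ (s • m) x) s := by
  have h1 : HasDerivAt (fun s : ℝ => x - s • m) (-m) s := by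
    simpa using ((hasDerivAt_id s).smul_const m).const_sub x
  have h2 := (((h1.norm_sq.const_mul δ).div_const 2).fun_neg.exp).mul_const (Real.exp (-V x))
  unfold gaussianReweight
  refine h2.congr_deriv ?_
  rw [inner_neg_right]
  ring

theorem hasDerivAt_integral_gaussianReweight_smul (hV : ConvexOn ℝ univ V)
    (hint : Integrable fun x => Real.exp (-V x)) (hδ : 0 ≤ δ) (m : EuclideanSpace ℝ ι) :
    HasDerivAt (fun s : ℝ => ∫ x, gaussianReweight V δ (s • m) x)
      (∫ x, δ * ⟪x - m, m⟫ * gaussianReweight V δ m x) 1 := by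
  have hmom : Integrable fun x => ‖x‖ * Real.exp (-V x) := by
    simpa using hV.integrable_norm_pow_mul_exp_neg hint 1
  have hbound : Integrable fun x =>
      δ * ‖m‖ * (‖x‖ * Real.exp (-V x)) + δ * ‖m‖ * (2 * ‖m‖) * Real.exp (-V x) :=
    (hmom.const_mul _).add (hint.const_mul _)
  have hcont' : Continuous fun x =>
      δ * ⟪x - (1 : ℝ) • m, m⟫ * gaussianReweight V δ ((1 : ℝ) • m) x := by
    have := continuous_gaussianReweight (δ := δ) hV ((1 : ℝ) • m)
    fun_prop
  have key := (hasDerivAt_integral_of_dominated_loc_of_deriv_le (𝕜 := ℝ) (x₀ := 1)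
    (s := Ioo (0 : ℝ) 2) (F := fun s x => gaussianReweight V δ (s • m) x)
    (F' := fun s x => δ * ⟪x - s • m, m⟫ * gaussianReweight V δ (s • m) x)
    (Ioo_mem_nhds (by norm_num) (by norm_num))
    (Eventually.of_forall fun s => (continuous_gaussianReweight hV _).aestronglyMeasurable)
    (integrable_gaussianReweight hV hint hδ _) hcont'.aestronglyMeasurable
    (ae_of_all _ fun x s hs => ?_) hbound
    (ae_of_all _ fun x s _ => hasDerivAt_gaussianReweight_smul m x s)).2
  · simpa using key
  · rw [norm_mul, norm_mul, Real.norm_of_nonneg hδ,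
      Real.norm_of_nonneg (gaussianReweight_pos _ _).le]
    have h1 : ‖x - s • m‖ ≤ ‖x‖ + 2 * ‖m‖ := by
      refine (norm_sub_le _ _).trans ?_
      rw [norm_smul, Real.norm_of_nonneg hs.1.le]
      gcongr
      exact hs.2.le
    calc δ * ‖⟪x - s • m, m⟫‖ * gaussianReweight V δ (s • m) x
        ≤ δ * ((‖x‖ + 2 * ‖m‖) * ‖m‖) * Real.exp (-V x) := by
          gcongr
          · exact (gaussianReweight_pos _ _).le
          · exact (norm_inner_le_norm _ _).trans (by gcongr)
          · exact gaussianReweight_le hδ _ _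
      _ = _ := by ring

/-- A fixed point of the reweighted barycenter map maximizes the mass of the reweighted density;
in particular, this mass is at least that for the weight centered at the origin. -/
theorem integral_gaussianReweight_zero_le (hV : ConvexOn ℝ univ V)
    (hint : Integrable fun x => Real.exp (-V x)) (hδ : 0 ≤ δ) {m : EuclideanSpace ℝ ι}
    (hm : ∫ x, gaussianReweight V δ m x • x = (∫ x, gaussianReweight V δ m x) • m) :
    ∫ x, gaussianReweight V δ 0 x ≤ ∫ x, gaussianReweight V δ m x := by
  have hI := integrable_gaussianReweight hV hint hδ m
  have hIx := integrable_gaussianReweight_smul hV hint hδ m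
  have hIm : Integrable fun x => gaussianReweight V δ m x • (x - m) := by
    simp_rw [smul_sub]
    exact hIx.sub (hI.smul_const m)
  have hzero : ∫ x, gaussianReweight V δ m x • (x - m) = 0 := by
    simp_rw [smul_sub]
    rw [integral_sub hIx (hI.smul_const m), integral_smul_const, hm, sub_self]
  have hderiv0 : ∫ x, δ * ⟪x - m, m⟫ * gaussianReweight V δ m x = 0 := by
    have h := integral_inner (𝕜 := ℝ) hIm m
    rw [hzero, inner_zero_right] at h
    have : ∀ x, δ * ⟪x - m, m⟫ * gaussianReweight V δ m x =
        δ * ⟪m, gaussianReweight V δ m x • (x - m)⟫ := fun x => by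
      rw [real_inner_smul_right, real_inner_comm]
      ring
    simp_rw [this]
    rw [integral_const_mul, h, mul_zero]
  have hderiv := hasDerivAt_integral_gaussianReweight_smul hV hint hδ m
  have hpos := fun s : ℝ => integral_gaussianReweight_pos hV hint hδ (s • m)
  rw [hderiv0] at hderiv
  have hlog := hderiv.log (hpos 1).ne'
  rw [zero_div] at hlog
  have := apply_le_of_hasDerivAt_zero_of_midpoint_concave (q := 0) hlog fun s => by
    have h := integral_gaussianReweight_mul_le_sq hV hint hδ (s • m) ((1 : ℝ) • m)
    rw [← add_smul, smul_smul, inv_mul_eq_div] at h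
    have h2 := Real.log_le_log (mul_pos (hpos s) (hpos 1)) h
    rw [Real.log_mul (hpos s).ne' (hpos 1).ne', Real.log_pow] at h2
    push_cast at h2
    linarith
  simpa using (Real.log_le_log_iff (hpos 0) (hpos 1)).1 this

theorem exp_le_integral_gaussianReweight_zero (hV : ConvexOn ℝ univ V)
    (hρ : ∫ x, Real.exp (-V x) = 1) (hδ : 0 ≤ δ) :
    Real.exp (-(δ / 2 * ∫ x, ‖x‖ ^ 2 * Real.exp (-V x))) ≤ ∫ x, gaussianReweight V δ 0 x := by
  have hint : Integrable fun x => Real.exp (-V x) := .of_integral_ne_zero (by simp [hρ])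
  set M := ∫ x, ‖x‖ ^ 2 * Real.exp (-V x) with hM
  set e := Real.exp (-(δ / 2 * M)) with he
  have h2 := hV.integrable_norm_pow_mul_exp_neg hint 2
  have hlin : ∫ x, (e * (1 + δ / 2 * M) * Real.exp (-V x) -
      e * (δ / 2) * (‖x‖ ^ 2 * Real.exp (-V x))) = e := by
    rw [integral_sub (hint.const_mul _) (h2.const_mul _), integral_const_mul,
      integral_const_mul, hρ, ← hM]
    ring
  rw [← hlin]
  refine integral_mono ((hint.const_mul _).sub (h2.const_mul _))
    (integrable_gaussianReweight hV hint hδ 0) fun x => ?_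
  have htan : e * (1 + δ / 2 * M - δ / 2 * ‖x‖ ^ 2) ≤ Real.exp (-(δ * ‖x - 0‖ ^ 2 / 2)) := by
    have h := Real.add_one_le_exp (δ / 2 * M - δ / 2 * ‖x‖ ^ 2)
    calc e * (1 + δ / 2 * M - δ / 2 * ‖x‖ ^ 2)
        ≤ e * Real.exp (δ / 2 * M - δ / 2 * ‖x‖ ^ 2) := by
          gcongr
          linarith
      _ = _ := by
          rw [he, ← Real.exp_add, sub_zero]
          ring_nf
  calc e * (1 + δ / 2 * M) * Real.exp (-V x) - e * (δ / 2) * (‖x‖ ^ 2 * Real.exp (-V x))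
      = e * (1 + δ / 2 * M - δ / 2 * ‖x‖ ^ 2) * Real.exp (-V x) := by ring
    _ ≤ gaussianReweight V δ 0 x := mul_le_mul_of_nonneg_right htan (Real.exp_pos _).le

end Barycenter

end

/-- **Uniform bound on the fixed point `m_δ`.**
For a log-concave probability density `ρ = e^{-V}` on `ℝⁿ` and `δ > 0`, the fixed point
`m_δ` of the reweighted barycenter map satisfies
`|m_δ| ≤ exp((δ/2) ∫ |x|² ρ(x) dx) ∫ |x| ρ(x) dx`. -/
theorem reweighted_barycenter_norm_bound
    {n : ℕ} (V : EuclideanSpace ℝ (Fin n) → ℝ) (hV : ConvexOn ℝ Set.univ V)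
    (hρ : (∫ x, Real.exp (-V x)) = 1)
    (δ : ℝ) (hδ : 0 < δ)
    (mδ : EuclideanSpace ℝ (Fin n))
    (hmδ : (∫ x, (Real.exp (-(δ * ‖x - mδ‖ ^ 2 / 2)) * Real.exp (-V x)) • x) =
      (∫ x, Real.exp (-(δ * ‖x - mδ‖ ^ 2 / 2)) * Real.exp (-V x)) • mδ) :
    ‖mδ‖ ≤ Real.exp (δ / 2 * ∫ x, ‖x‖ ^ 2 * Real.exp (-V x)) * ∫ x, ‖x‖ * Real.exp (-V x) := by
  have hint : Integrable fun x => Real.exp (-V x) := .of_integral_ne_zero (by simp [hρ])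
  have hmom : Integrable fun x => ‖x‖ * Real.exp (-V x) := by
    simpa using hV.integrable_norm_pow_mul_exp_neg hint 1
  have hm : ∫ x, gaussianReweight V δ mδ x • x = (∫ x, gaussianReweight V δ mδ x) • mδ := hmδ
  have hpos := integral_gaussianReweight_pos hV hint hδ.le mδ
  have hlow := (exp_le_integral_gaussianReweight_zero hV hρ hδ.le).trans
    (integral_gaussianReweight_zero_le hV hint hδ.le hm)
  have hup : (∫ x, gaussianReweight V δ mδ x) * ‖mδ‖ ≤ ∫ x, ‖x‖ * Real.exp (-V x) := by
    rw [← Real.norm_of_nonneg hpos.le, ← norm_smul, ← hm]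
    refine norm_integral_le_of_norm_le hmom (ae_of_all _ fun x => ?_)
    rw [norm_smul, Real.norm_of_nonneg (gaussianReweight_pos _ _).le, mul_comm]
    gcongr
    exact gaussianReweight_le hδ.le _ _
  rw [Real.exp_neg] at hlow
  rw [← inv_mul_le_iff₀ (Real.exp_pos _)]
  exact (mul_le_mul_of_nonneg_right hlow (norm_nonneg _)).trans hup
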